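/- Let 𝒦 be a complete category. Then the free coproduct completion Σ𝒦 is an elementary topos (i.e., is finitely complete, cartesian closed, and has a subobject classifier) if and only if 𝒦 is a multi-topos (i.e., is finitely complete, cartesian multi-closed, and has a subobject classifier). -/

import Mathlib

/- Common definitions for formalizing "How nice are free completions of categories?"
   by Adámek and Rosický. -/

open CategoryTheory CategoryTheory.Limits

universe w w₁ w₂ v₁ u₁

namespace FreeCompletions

/-- A presheaf is *small* if it is a colimit of representables over a small
(`Type w`-indexed) diagram. -/
def IsSmallPresheaf {C : Type u₁} [Category.{v₁} C] (F : Cᵒᵖ ⥤ Type v₁) : Prop :=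
  ∃ (J : Type w) (_ : SmallCategory J) (D : J ⥤ C) (c : Cocone (D ⋙ yoneda)),
    Nonempty (IsColimit c) ∧ Nonempty (c.pt ≅ F)

/-- A presheaf is a (small) coproduct of representables. -/
def IsCoproductOfRepresentables {C : Type u₁} [Category.{v₁} C] (F : Cᵒᵖ ⥤ Type v₁) : Prop :=
  ∃ (I : Type v₁) (A : I → C), Nonempty (F ≅ ∐ fun i => yoneda.obj (A i))

/-- The free coproduct completion `Σ𝒦`, realized as the full subcategory of presheaves
consisting of coproducts of representables. -/
abbrev SigmaCompletion (K : Type u₁) [Category.{v₁} K] :=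
  ObjectProperty.FullSubcategory (IsCoproductOfRepresentables (C := K))

/-- The free colimit completion `𝒫𝒦`, the full subcategory of presheaves
consisting of the small presheaves. -/
abbrev PCompletion (K : Type u₁) [Category.{v₁} K] :=
  ObjectProperty.FullSubcategory (IsSmallPresheaf.{v₁} (C := K))

/-- The object of `Σ𝒦` given by a small family of objects of `𝒦`. -/
noncomputable def famObj {K : Type u₁} [Category.{v₁} K] {I : Type v₁} (B : I → K) :
    SigmaCompletion K :=
  ⟨∐ fun i => yoneda.obj (B i), ⟨I, B, ⟨Iso.refl _⟩⟩⟩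

theorem isSmallPresheaf_coprod {K : Type u₁} [Category.{v₁} K] {I : Type v₁} (B : I → K) :
    IsSmallPresheaf.{v₁} (∐ fun i => yoneda.obj (B i)) := by
  let G := Discrete.functor (fun i => yoneda.obj (B i))
  let e : Discrete.functor B ⋙ yoneda ≅ G := Discrete.natIso (fun i => Iso.refl _)
  exact ⟨Discrete I, inferInstance, Discrete.functor B,
    (Cocone.precompose e.hom).obj (colimit.cocone G),
    ⟨(IsColimit.precomposeHomEquiv e (colimit.cocone G)).symm (colimit.isColimit G)⟩,
    ⟨Iso.refl _⟩⟩

/-- The object of `𝒫𝒦` given by a small coproduct of representables. -/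
noncomputable def pcoprodObj {K : Type u₁} [Category.{v₁} K] {I : Type v₁} (B : I → K) :
    PCompletion K :=
  ⟨∐ fun i => yoneda.obj (B i), isSmallPresheaf_coprod B⟩

/-- A diagram `D` has a *multi-limit*: a set of cones through which every cone
factorizes uniquely (unique member and unique factorization). -/
def HasMultiLimit {J : Type w₁} [Category.{w₂} J] {C : Type u₁} [Category.{v₁} C]
    (D : J ⥤ C) : Prop :=
  ∃ (T : Type w) (c : T → Cone D), ∀ s : Cone D,
    ∃ p : Σ t : T, s ⟶ c t, ∀ q : Σ t : T, s ⟶ c t, q = p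

/-- `𝒦` is finitely multi-complete: every finite diagram has a multi-limit. -/
def FinitelyMultiComplete (C : Type u₁) [Category.{v₁} C] : Prop :=
  ∀ (J : Type) [SmallCategory J] [FinCategory J] (D : J ⥤ C), HasMultiLimit.{v₁} D

/-- A family `A : I → C` has a *multi-product*: a set of cones through which every cone
factorizes uniquely (unique member and unique factorization). -/
def HasMultiProduct {C : Type u₁} [Category.{v₁} C] {I : Type w₁} (A : I → C) : Prop :=
  ∃ (T : Type w) (P : T → C) (π : ∀ t i, P t ⟶ A i),
    ∀ (X : C) (f : ∀ i, X ⟶ A i),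
      ∃ p : Σ t : T, X ⟶ P t, (∀ i, p.2 ≫ π p.1 i = f i) ∧
        ∀ q : Σ t : T, X ⟶ P t, (∀ i, q.2 ≫ π q.1 i = f i) → q = p

/-- `C` has multi-products of all set-indexed families. -/
def HasMultiProducts (C : Type u₁) [Category.{v₁} C] : Prop :=
  ∀ (I : Type v₁) (A : I → C), HasMultiProduct.{v₁} A

/-- A diagram `D` has a *pre-limit*: a set of cones through which every cone
factorizes (not necessarily uniquely). -/
def HasPreLimit {J : Type w₁} [Category.{w₂} J] {C : Type u₁} [Category.{v₁} C]
    (D : J ⥤ C) : Prop :=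
  ∃ (T : Type w) (c : T → Cone D), ∀ s : Cone D, ∃ t : T, Nonempty (s ⟶ c t)

/-- `C` is pre-complete: every small diagram has a pre-limit. -/
def PreComplete (C : Type u₁) [Category.{v₁} C] : Prop :=
  ∀ (J : Type v₁) [SmallCategory J] (D : J ⥤ C), HasPreLimit.{v₁} D

/-- `C` is finitely pre-complete: every finite diagram has a pre-limit. -/
def FinitelyPreComplete (C : Type u₁) [Category.{v₁} C] : Prop :=
  ∀ (J : Type) [SmallCategory J] [FinCategory J] (D : J ⥤ C), HasPreLimit.{v₁} D

/-- A family `A : I → C` has a *pre-product*: a set of cones through which every cone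
factorizes (not necessarily uniquely). -/
def HasPreProduct {C : Type u₁} [Category.{v₁} C] {I : Type w₁} (A : I → C) : Prop :=
  ∃ (T : Type w) (P : T → C) (π : ∀ t i, P t ⟶ A i),
    ∀ (X : C) (f : ∀ i, X ⟶ A i), ∃ (t : T) (h : X ⟶ P t), ∀ i, h ≫ π t i = f i

/-- `C` (with finite products) is cartesian multi-closed: each functor `A × -` is a
left multi-adjoint. -/
def CartesianMultiClosedOf (C : Type u₁) [Category.{v₁} C] [HasFiniteProducts C] : Prop :=
  ∀ A B : C, ∃ (I : Type v₁) (E : I → C) (ev : ∀ i, A ⨯ E i ⟶ B),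
    ∀ (X : C) (c : A ⨯ X ⟶ B),
      ∃ p : Σ i : I, X ⟶ E i, (prod.map (𝟙 A) p.2 ≫ ev p.1 = c) ∧
        ∀ q : Σ i : I, X ⟶ E i, prod.map (𝟙 A) q.2 ≫ ev q.1 = c → q = p

/-- `C` is cartesian multi-closed: it has finite products and each functor `A × -` is a
left multi-adjoint. -/
def CartesianMultiClosed (C : Type u₁) [Category.{v₁} C] : Prop :=
  ∃ h : HasFiniteProducts C, @CartesianMultiClosedOf C _ h

/-- `C` is cartesian closed (as a property: it has finite products and each `A × -`
is a left adjoint). -/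
def CartesianClosedP (C : Type u₁) [Category.{v₁} C] : Prop :=
  ∃ h : CartesianMonoidalCategory C, Nonempty (@MonoidalClosed C _ h.toMonoidalCategory)

/-- `C` is locally cartesian closed: every slice category is cartesian closed. -/
def LocallyCartesianClosedP (C : Type u₁) [Category.{v₁} C] : Prop :=
  ∀ A : C, CartesianClosedP (Over A)

/-- `C` is locally cartesian multi-closed: every slice category is cartesian multi-closed. -/
def LocallyCartesianMultiClosed (C : Type u₁) [Category.{v₁} C] : Prop :=
  ∀ A : C, CartesianMultiClosed (Over A)

/-- `C` (with finite products) is cartesian pre-closed: each functor `C(A × -, B)`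
is a small presheaf. -/
def CartesianPreClosedOf (C : Type u₁) [Category.{v₁} C] [HasFiniteProducts C] : Prop :=
  ∀ A B : C, IsSmallPresheaf.{w} ((prod.functor.obj A).op ⋙ yoneda.obj B)

/-- `C` is cartesian pre-closed: it has finite products and each functor `C(A × -, B)`
is a small presheaf. -/
def CartesianPreClosed (C : Type u₁) [Category.{v₁} C] : Prop :=
  ∃ h : HasFiniteProducts C, @CartesianPreClosedOf.{w} C _ h

/-- `C` (with binary products) has weak simple products. -/
def HasWeakSimpleProductsOf (C : Type u₁) [Category.{v₁} C] [HasBinaryProducts C] : Prop :=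
  ∀ (A X B : C) (b : B ⟶ A ⨯ X),
    ∃ (P : C) (ε : A ⨯ P ⟶ B) (w : P ⟶ X),
      ε ≫ b = prod.map (𝟙 A) w ∧
      ∀ (P' : C) (ε' : A ⨯ P' ⟶ B) (w' : P' ⟶ X), ε' ≫ b = prod.map (𝟙 A) w' →
        ∃ f : P' ⟶ P, ε' = prod.map (𝟙 A) f ≫ ε ∧ w' = f ≫ w

/-- `C` has binary products and weak simple products. -/
def HasWeakSimpleProducts (C : Type u₁) [Category.{v₁} C] : Prop :=
  ∃ h : HasBinaryProducts C, @HasWeakSimpleProductsOf C _ h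

/-- `C` has a subobject classifier: a mono `ε : 1 ⟶ Ω` from the terminal object such that
every monomorphism is a pullback of `ε` along a unique morphism. -/
def HasSubobjectClassifierP (C : Type u₁) [Category.{v₁} C] : Prop :=
  ∃ (T Ω : C) (hT : IsTerminal T) (ε : T ⟶ Ω), Mono ε ∧
    ∀ ⦃U X : C⦄ (m : U ⟶ X), Mono m → ∃! χ : X ⟶ Ω, IsPullback (hT.from U) m ε χ

/-- `C` is an elementary topos: finitely complete, cartesian closed,
with a subobject classifier. -/
def IsElementaryTopos (C : Type u₁) [Category.{v₁} C] : Prop :=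
  HasFiniteLimits C ∧ CartesianClosedP C ∧ HasSubobjectClassifierP C

/-- `C` is a multi-topos: finitely complete, cartesian multi-closed,
with a subobject classifier. -/
def IsMultiTopos (C : Type u₁) [Category.{v₁} C] : Prop :=
  HasFiniteLimits C ∧ CartesianMultiClosed C ∧ HasSubobjectClassifierP C

/-- A coproduct cocone is *universal*: it is stable under pullback. -/
def CofanUniversal {C : Type u₁} [Category.{v₁} C] {I : Type w₁} {X : I → C}
    (c : Cofan X) : Prop :=
  ∀ {W : C} (h : W ⟶ c.pt) (Y : I → C) (p : ∀ i, Y i ⟶ W) (q : ∀ i, Y i ⟶ X i),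
    (∀ i, IsPullback (p i) (q i) h (c.inj i)) → Nonempty (IsColimit (Cofan.mk W p))

/-- A coproduct cocone is *disjoint*: injections are monic with initial pairwise
intersections. -/
def CofanDisjoint {C : Type u₁} [Category.{v₁} C] {I : Type w₁} {X : I → C}
    (c : Cofan X) : Prop :=
  (∀ i, Mono (c.inj i)) ∧
    ∀ i j, i ≠ j → ∀ {Z : C} (u : Z ⟶ X i) (v : Z ⟶ X j),
      IsPullback u v (c.inj i) (c.inj j) → Nonempty (IsInitial Z)

/-- `C` is extensive: finitely complete, with finite coproducts which are
universal and disjoint. -/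
def IsExtensive (C : Type u₁) [Category.{v₁} C] : Prop :=
  HasFiniteLimits C ∧ HasFiniteCoproducts C ∧
    ∀ (I : Type) [Finite I] (X : I → C) (c : Cofan X),
      Nonempty (IsColimit c) → CofanUniversal c ∧ CofanDisjoint c

/-- `C` is infinitary extensive: finitely complete, with small (`Type w`-indexed)
coproducts which are universal and disjoint. -/
def IsInfinitaryExtensive (C : Type u₁) [Category.{v₁} C] : Prop :=
  HasFiniteLimits C ∧ HasCoproducts.{w} C ∧
    ∀ (I : Type w) (X : I → C) (c : Cofan X),
      Nonempty (IsColimit c) → CofanUniversal c ∧ CofanDisjoint c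

/-- A parallel pair `r₁ r₂ : R ⟶ X` is an (internal) equivalence relation. -/
structure IsEquivalenceRelationPair {C : Type u₁} [Category.{v₁} C] {R X : C}
    (r₁ r₂ : R ⟶ X) : Prop where
  jointlyMono : ∀ {Z : C} (a b : Z ⟶ R), a ≫ r₁ = b ≫ r₁ → a ≫ r₂ = b ≫ r₂ → a = b
  refl : ∀ {Z : C} (f : Z ⟶ X), ∃ d : Z ⟶ R, d ≫ r₁ = f ∧ d ≫ r₂ = f
  symm : ∃ s : R ⟶ R, s ≫ r₁ = r₂ ∧ s ≫ r₂ = r₁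
  trans : ∀ {Z : C} (a b : Z ⟶ R), a ≫ r₂ = b ≫ r₁ →
    ∃ t : Z ⟶ R, t ≫ r₁ = a ≫ r₁ ∧ t ≫ r₂ = b ≫ r₂

/-- `C` is a regular category: finitely complete, with (regular epi, mono)
factorizations, and regular epimorphisms are stable under pullback. -/
def IsRegularCat (C : Type u₁) [Category.{v₁} C] : Prop :=
  HasFiniteLimits C ∧
    (∀ {X Y : C} (f : X ⟶ Y), ∃ (Z : C) (e : X ⟶ Z) (m : Z ⟶ Y),
      e ≫ m = f ∧ Nonempty (RegularEpi e) ∧ Mono m) ∧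
    (∀ {P X Y Z : C} (fst : P ⟶ X) (snd : P ⟶ Y) (f : X ⟶ Z) (g : Y ⟶ Z),
      IsPullback fst snd f g → Nonempty (RegularEpi g) → Nonempty (RegularEpi fst))

/-- `C` is an exact (Barr-exact) category: regular with effective equivalence relations. -/
def IsExactCat (C : Type u₁) [Category.{v₁} C] : Prop :=
  IsRegularCat C ∧
    ∀ {R X : C} (r₁ r₂ : R ⟶ X), IsEquivalenceRelationPair r₁ r₂ →
      ∃ (Y : C) (f : X ⟶ Y), IsPullback r₁ r₂ f f

/-- A pretopos is an exact and extensive category. -/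
def IsPretopos (C : Type u₁) [Category.{v₁} C] : Prop :=
  IsExactCat C ∧ IsExtensive C

/-- `C` is additive: preadditive with finite biproducts. -/
def IsAdditive (C : Type u₁) [Category.{v₁} C] : Prop :=
  ∃ p : Preadditive C, letI := p; HasFiniteBiproducts C

/-- `C` is wellpowered: every object has only a set of subobjects. -/
def Wellpowered (C : Type u₁) [Category.{v₁} C] : Prop :=
  ∀ X : C, Small.{w} (Subobject X)

/-- `C` is cowellpowered: every object has only a set of quotient objects. -/
def Cowellpowered (C : Type u₁) [Category.{v₁} C] : Prop :=
  ∀ X : C, Small.{w} (Subobject (Opposite.op X))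

/-- `C` has a clique-like class of objects, indexed by all ordinals. -/
def HasCliqueLikeClass (C : Type u₁) [Category.{v₁} C] : Prop :=
  ∃ (A : Ordinal.{v₁} → C) (R : MorphismProperty C),
    (∀ {X Y Z : C} (v : X ⟶ Y) (u : Y ⟶ Z), R (v ≫ u) → R u) ∧
    (∀ k, ∃ f g : A 0 ⟶ A k, f ≠ g ∧ R f ∧ R g) ∧
    ((∀ i k : Ordinal.{v₁}, 0 < i → i < k → ∀ f : A k ⟶ A i, ¬ R f) ∨
     (∀ k i : Ordinal.{v₁}, 0 < k → k < i → ∀ f : A k ⟶ A i, ¬ R f))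

/-- A presheaf is petty: a quotient of a small coproduct of representables. -/
def IsPetty {C : Type u₁} [Category.{v₁} C] (F : Cᵒᵖ ⥤ Type v₁) : Prop :=
  ∃ (I : Type v₁) (A : I → C) (e : (∐ fun i => yoneda.obj (A i)) ⟶ F), Epi e

/-- A presheaf is lucid: petty, and equalizers of pairs of morphisms from petty
presheaves into it are petty. -/
noncomputable def IsLucid {C : Type u₁} [Category.{v₁} C] (F : Cᵒᵖ ⥤ Type v₁) : Prop :=
  IsPetty F ∧ ∀ (P : Cᵒᵖ ⥤ Type v₁), IsPetty P → ∀ u₁ u₂ : P ⟶ F, IsPetty (equalizer u₁ u₂)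


section Helpers

universe v u v₂ u₂

open FormalCoproduct MonoidalCategory CartesianMonoidalCategory Opposite

/-! ### Invariance under equivalence -/

theorem HasSubobjectClassifierP.toClassifier {C : Type u} [Category.{v} C]
    (h : HasSubobjectClassifierP C) : Nonempty (Subobject.Classifier C) := by
  obtain ⟨T, Ω, hT, ε, _, h⟩ := h
  choose χ h1 h2 using h
  exact ⟨Subobject.Classifier.mkOfTerminalΩ₀ T hT Ω ε (fun m hm => χ m hm)
    (fun m hm => (h1 m hm).flip) (fun m hm χ' h' => h2 m hm χ' h'.flip)⟩

theorem HasSubobjectClassifierP.ofClassifier {C : Type u} [Category.{v} C]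
    (c : Subobject.Classifier C) {T : C} (hT : IsTerminal T) :
    ∃ (Ω : C) (ε : T ⟶ Ω), Mono ε ∧
      ∀ ⦃U X : C⦄ (m : U ⟶ X), Mono m → ∃! χ : X ⟶ Ω, IsPullback (hT.from U) m ε χ := by
  let e : T ≅ c.Ω₀ := hT.uniqueUpToIso c.isTerminalΩ₀
  refine ⟨c.Ω, e.hom ≫ c.truth, inferInstance, fun U X m hm => ⟨c.χ m, ?_, ?_⟩⟩
  · refine (c.isPullback m).flip.of_iso (Iso.refl _) e.symm (Iso.refl _) (Iso.refl _) ?_ ?_ ?_ ?_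
    · exact hT.hom_ext _ _
    · simp
    · simp
    · simp
  · intro χ' h'
    have : IsPullback m (hT.from U ≫ e.hom) χ' c.truth := by
      refine h'.flip.of_iso (Iso.refl _) (Iso.refl _) e (Iso.refl _) ?_ ?_ ?_ ?_
      all_goals simp
    exact c.uniq m this

theorem HasSubobjectClassifierP.ofEquiv {C : Type u} [Category.{v} C]
    {D : Type u₂} [Category.{v₂} D] (e : C ≌ D)
    (h : HasSubobjectClassifierP C) : HasSubobjectClassifierP D := by
  obtain ⟨c⟩ := h.toClassifier
  let d := c.ofEquivalence e
  obtain ⟨Ω, ε, h1, h2⟩ := HasSubobjectClassifierP.ofClassifier d d.isTerminalΩ₀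
  exact ⟨_, Ω, _, ε, h1, h2⟩

theorem IsElementaryTopos.ofEquiv {C : Type u} [Category.{v} C]
    {D : Type u₂} [Category.{v₂} D] (e : C ≌ D)
    (h : IsElementaryTopos C) : IsElementaryTopos D := by
  obtain ⟨h1, ⟨h2, ⟨h3⟩⟩, h4⟩ := h
  have hD : HasFiniteLimits D := ⟨fun J _ _ => Adjunction.hasLimitsOfShape_of_equivalence e.inverse⟩
  refine ⟨hD, ?_, h4.ofEquiv e⟩
  let _ : CartesianMonoidalCategory D := .ofHasFiniteProducts
  exact ⟨inferInstance, ⟨cartesianClosedOfEquiv e⟩⟩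

/-! ### Formal coproducts and sigma types -/

variable {K : Type u} [Category.{v} K]

/-- A morphism of families at an index, as an element of a sigma type. -/
def sg {X Y : FormalCoproduct.{v} K} (f : X ⟶ Y) (i : X.I) : Σ j : Y.I, X.obj i ⟶ Y.obj j :=
  ⟨f.f i, f.φ i⟩

/-- Build a morphism of families. -/
def ofSg {X Y : FormalCoproduct.{v} K} (s : ∀ i : X.I, Σ j : Y.I, X.obj i ⟶ Y.obj j) : X ⟶ Y :=
  ⟨fun i => (s i).1, fun i => (s i).2⟩

theorem sg_ofSg {X Y : FormalCoproduct.{v} K} (s : ∀ i : X.I, Σ j : Y.I, X.obj i ⟶ Y.obj j)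
    (i : X.I) : sg (ofSg s) i = s i := rfl

theorem sg_ext {X Y : FormalCoproduct.{v} K} {f g : X ⟶ Y} (h : ∀ i, sg f i = sg g i) : f = g := by
  have : ofSg (sg f) = ofSg (sg g) := by rw [funext h]
  exact this

/-- Composition on sigma types. -/
def sgMap {X Y : FormalCoproduct.{v} K} (g : X ⟶ Y) {Z : K} (q : Σ j : X.I, Z ⟶ X.obj j) :
    Σ j : Y.I, Z ⟶ Y.obj j := ⟨g.f q.1, q.2 ≫ g.φ q.1⟩

theorem sg_comp {X Y Z : FormalCoproduct.{v} K} (f : X ⟶ Y) (g : Y ⟶ Z) (i : X.I) :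
    sg (f ≫ g) i = sgMap g (sg f i) := rfl

/-! ### The equivalence -/

/-- The presheaf of a family. -/
@[simps]
def famPsh (X : FormalCoproduct.{v} K) : Kᵒᵖ ⥤ Type v where
  obj Z := Σ i : X.I, Z.unop ⟶ X.obj i
  map g := TypeCat.ofHom (fun q => ⟨q.1, g.unop ≫ q.2⟩)

/-- The presheaf functor of families. -/
@[simps]
def famPshFunctor : FormalCoproduct.{v} K ⥤ (Kᵒᵖ ⥤ Type v) where
  obj := famPsh
  map {X Y} f :=
    { app := fun Z => TypeCat.ofHom (fun q => sgMap f q)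
      naturality := fun Z Z' g => by
        ext q
        exact Sigma.ext rfl (heq_of_eq (Category.assoc _ _ _)) }
  map_id X := by
    ext Z q
    exact Sigma.ext rfl (heq_of_eq (Category.comp_id _))
  map_comp f g := by
    ext Z q
    exact Sigma.ext rfl (heq_of_eq (Category.assoc _ _ _).symm)

theorem famPsh_nat {X Y : FormalCoproduct.{v} K} (η : famPsh X ⟶ famPsh Y) {Z : K}
    (q : Σ j : X.I, Z ⟶ X.obj j) :
    η.app (op Z) q = ⟨(η.app (op (X.obj q.1)) ⟨q.1, 𝟙 _⟩).1,
      q.2 ≫ (η.app (op (X.obj q.1)) ⟨q.1, 𝟙 _⟩).2⟩ := by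
  have h := ConcreteCategory.congr_hom (η.naturality q.2.op) (⟨q.1, 𝟙 _⟩ : Σ j, X.obj q.1 ⟶ X.obj j)
  have h2 : ((famPsh X).map q.2.op) (⟨q.1, 𝟙 _⟩ : Σ j, X.obj q.1 ⟶ X.obj j) = q :=
    Sigma.ext rfl (heq_of_eq (Category.comp_id _))
  have h3 := (congrArg (η.app (op Z)) h2).symm.trans h
  exact h3

/-- The presheaf functor is fully faithful. -/
def famPshFF : (famPshFunctor (K := K)).FullyFaithful where
  preimage {X Y} η := ofSg (fun i => η.app (op (X.obj i)) ⟨i, 𝟙 _⟩)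
  map_preimage {X Y} η := by
    ext Z q
    exact (famPsh_nat η q).symm
  preimage_map {X Y} f := by
    apply sg_ext
    intro i
    exact Sigma.ext rfl (heq_of_eq (Category.id_comp _))

/-- The cofan exhibiting a family presheaf as a coproduct of representables. -/
def famPshCofan (X : FormalCoproduct.{v} K) : Cofan (fun i => yoneda.obj (X.obj i)) :=
  Cofan.mk (famPsh X) (fun i => { app := fun Z => TypeCat.ofHom (fun f => ⟨i, f⟩) })

/-- The cofan is a colimit. -/
def famPshCofanIsColimit (X : FormalCoproduct.{v} K) : IsColimit (famPshCofan X) :=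
  Cofan.IsColimit.mk _
    (fun s => { app := fun Z => TypeCat.ofHom (fun q => (s.inj q.1).app Z q.2)
                naturality := fun Z Z' g => by
                  ext q
                  exact ConcreteCategory.congr_hom ((s.inj q.1).naturality g) q.2 })
    (fun s i => by
      ext Z q
      rfl)
    (fun s m h => by
      ext Z q
      have h' := congrArg (fun t : yoneda.obj (X.obj q.1) ⟶ s.pt => t.app Z) (h q.1)
      exact ConcreteCategory.congr_hom h' q.2)

theorem famPsh_mem (X : FormalCoproduct.{v} K) : IsCoproductOfRepresentables (famPsh X) :=
  ⟨X.I, X.obj, ⟨(famPshCofanIsColimit X).coconePointUniqueUpToIso (colimit.isColimit _)⟩⟩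

/-- Families to the free coproduct completion. -/
def famToSigma : FormalCoproduct.{v} K ⥤ SigmaCompletion K :=
  ObjectProperty.lift _ famPshFunctor famPsh_mem

theorem famToSigma_isEquivalence : (famToSigma (K := K)).IsEquivalence := by
  have h1 : (famPshFunctor (K := K)).Full := famPshFF.full
  have h2 : (famPshFunctor (K := K)).Faithful := famPshFF.faithful
  refine { faithful := ?_, full := ?_, essSurj := ⟨?_⟩ }
  · exact Functor.Faithful.of_comp_iso (ObjectProperty.liftCompιIso _ famPshFunctor famPsh_mem)
  · exact Functor.Full.of_comp_faithful_iso (ObjectProperty.liftCompιIso _ famPshFunctor famPsh_mem)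
  · rintro ⟨F, I, A, ⟨e⟩⟩
    let X : FormalCoproduct.{v} K := ⟨I, A⟩
    refine ⟨X, ⟨ObjectProperty.isoMk _ ?_⟩⟩
    exact (famPshCofanIsColimit X).coconePointUniqueUpToIso (colimit.isColimit _) ≪≫ e.symm

theorem topos_sigma_iff : IsElementaryTopos (SigmaCompletion K) ↔
    IsElementaryTopos (FormalCoproduct.{v} K) := by
  have := famToSigma_isEquivalence (K := K)
  exact ⟨fun h => h.ofEquiv (famToSigma (K := K)).asEquivalence.symm,
    fun h => h.ofEquiv (famToSigma (K := K)).asEquivalence⟩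

/-! ### Cartesian closedness -/

/-- The explicit binary product of families. -/
noncomputable def famProd [HasBinaryProducts K] (A X : FormalCoproduct.{v} K) :
    FormalCoproduct.{v} K :=
  ⟨A.I × X.I, fun p => A.obj p.1 ⨯ X.obj p.2⟩

/-- Functoriality of `famProd`. -/
noncomputable def famProdMap [HasBinaryProducts K] (A : FormalCoproduct.{v} K)
    {X Y : FormalCoproduct.{v} K} (g : X ⟶ Y) : famProd A X ⟶ famProd A Y :=
  ⟨fun p => (p.1, g.f p.2), fun p => prod.map (𝟙 _) (g.φ p.2)⟩

/-- First projection. -/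
noncomputable def famFst [HasBinaryProducts K] (A X : FormalCoproduct.{v} K) : famProd A X ⟶ A :=
  ⟨fun p => p.1, fun _ => prod.fst⟩

/-- Second projection. -/
noncomputable def famSnd [HasBinaryProducts K] (A X : FormalCoproduct.{v} K) : famProd A X ⟶ X :=
  ⟨fun p => p.2, fun _ => prod.snd⟩

/-- Pairing. -/
noncomputable def famLift [HasBinaryProducts K] {W A X : FormalCoproduct.{v} K} (f : W ⟶ A)
    (g : W ⟶ X) : W ⟶ famProd A X :=
  ⟨fun w => (f.f w, g.f w), fun w => prod.lift (f.φ w) (g.φ w)⟩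

theorem famLift_fst [HasBinaryProducts K] {W A X : FormalCoproduct.{v} K} (f : W ⟶ A)
    (g : W ⟶ X) : famLift f g ≫ famFst A X = f :=
  sg_ext fun _ => Sigma.ext rfl (heq_of_eq (prod.lift_fst _ _))

theorem famLift_snd [HasBinaryProducts K] {W A X : FormalCoproduct.{v} K} (f : W ⟶ A)
    (g : W ⟶ X) : famLift f g ≫ famSnd A X = g :=
  sg_ext fun _ => Sigma.ext rfl (heq_of_eq (prod.lift_snd _ _))

theorem famLift_eta [HasBinaryProducts K] {W A X : FormalCoproduct.{v} K} (f : W ⟶ famProd A X) :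
    famLift (f ≫ famFst A X) (f ≫ famSnd A X) = f :=
  sg_ext fun _ => Sigma.ext rfl (heq_of_eq (by
    apply Limits.prod.hom_ext
    · exact prod.lift_fst _ _
    · exact prod.lift_snd _ _))

theorem famProd_ext [HasBinaryProducts K] {W A X : FormalCoproduct.{v} K} {f g : W ⟶ famProd A X}
    (h1 : f ≫ famFst A X = g ≫ famFst A X) (h2 : f ≫ famSnd A X = g ≫ famSnd A X) : f = g := by
  rw [← famLift_eta f, ← famLift_eta g, h1, h2]

theorem famProdMap_fst [HasBinaryProducts K] (A : FormalCoproduct.{v} K)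
    {X Y : FormalCoproduct.{v} K} (g : X ⟶ Y) :
    famProdMap A g ≫ famFst A Y = famFst A X :=
  sg_ext fun _ => Sigma.ext rfl (heq_of_eq ((prod.map_fst _ _).trans (Category.comp_id _)))

theorem famProdMap_snd [HasBinaryProducts K] (A : FormalCoproduct.{v} K)
    {X Y : FormalCoproduct.{v} K} (g : X ⟶ Y) :
    famProdMap A g ≫ famSnd A Y = famSnd A X ≫ g :=
  sg_ext fun _ => Sigma.ext rfl (heq_of_eq (prod.map_snd _ _))

/-- Comparison with the tensor product. -/
noncomputable def famProdIso [HasBinaryProducts K] [CartesianMonoidalCategory (FormalCoproduct.{v} K)]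
    (A X : FormalCoproduct.{v} K) : famProd A X ≅ A ⊗ X where
  hom := CartesianMonoidalCategory.lift (famFst A X) (famSnd A X)
  inv := famLift (fst A X) (snd A X)
  hom_inv_id := by
    apply famProd_ext <;> simp [famLift_fst, famLift_snd]
  inv_hom_id := by
    apply CartesianMonoidalCategory.hom_ext <;> simp [famLift_fst, famLift_snd]

theorem famProdIso_nat [HasBinaryProducts K] [CartesianMonoidalCategory (FormalCoproduct.{v} K)]
    (A : FormalCoproduct.{v} K) {X Y : FormalCoproduct.{v} K} (g : X ⟶ Y) :
    famProdMap A g ≫ (famProdIso A Y).hom = (famProdIso A X).hom ≫ A ◁ g := by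
  apply CartesianMonoidalCategory.hom_ext <;>
    simp [famProdIso, famProdMap_fst, famProdMap_snd]

theorem cartesianClosedP_of_criterion [HasFiniteLimits K]
    (h : ∀ A B : FormalCoproduct.{v} K, ∃ (E : FormalCoproduct.{v} K) (ev : famProd A E ⟶ B),
      ∀ (X : FormalCoproduct.{v} K) (c : famProd A X ⟶ B),
        ∃! g : X ⟶ E, famProdMap A g ≫ ev = c) :
    CartesianClosedP (FormalCoproduct.{v} K) := by
  have hf : HasFiniteLimits (FormalCoproduct.{v} K) :=
    hasFiniteLimits_of_hasTerminal_and_pullbacks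
  let _ : CartesianMonoidalCategory (FormalCoproduct.{v} K) := .ofHasFiniteProducts
  refine ⟨inferInstance, ⟨⟨fun A => ?_⟩⟩⟩
  choose E ev cur hcur huniq using h
  have key : ∀ {X Y B : FormalCoproduct.{v} K} (g : X ⟶ Y) (k : Y ⟶ E A B),
      famProdMap A (g ≫ k) = famProdMap A g ≫ famProdMap A k := by
    intro X Y B g k
    apply famProd_ext
    · simp [famProdMap_fst]
    · rw [famProdMap_snd, Category.assoc, famProdMap_snd, ← Category.assoc, ← Category.assoc,
        famProdMap_snd]
  let e : ∀ X B : FormalCoproduct.{v} K, ((tensorLeft A).obj X ⟶ B) ≃ (X ⟶ E A B) := fun X B =>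
    { toFun := fun c => cur A B X ((famProdIso A X).hom ≫ c)
      invFun := fun g => (famProdIso A X).inv ≫ famProdMap A g ≫ ev A B
      left_inv := fun c => by
        have := hcur A B X ((famProdIso A X).hom ≫ c)
        simp only at this
        simp [this]
      right_inv := fun g => by
        symm
        apply huniq
        simp }
  refine ⟨_, Adjunction.adjunctionOfEquivRight e ?_⟩
  intro X' X B f g
  symm
  apply huniq
  have := hcur A B X ((famProdIso A X).hom ≫ g)
  simp only at this
  change famProdMap A (f ≫ cur A B X ((famProdIso A X).hom ≫ g)) ≫ ev A B = _
  rw [key, Category.assoc, this, ← Category.assoc, famProdIso_nat]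
  simp

/-- Assemble a family of sigma elements into an element for the product. -/
noncomputable def pack [HasProducts.{v} K] {I : Type v} {S : I → Type v} (E : ∀ i, S i → K) {X : K}
    (q : ∀ i, Σ s : S i, X ⟶ E i s) :
    Σ s : ∀ i, S i, X ⟶ ∏ᶜ fun i => E i (s i) :=
  ⟨fun i => (q i).1, Pi.lift fun i => (q i).2⟩

theorem pack_unpack [HasProducts.{v} K] {I : Type v} {S : I → Type v} (E : ∀ i, S i → K) {X : K}
    (p : Σ s : ∀ i, S i, X ⟶ ∏ᶜ fun i => E i (s i)) :
    pack E (fun i => ⟨p.1 i, p.2 ≫ Pi.π _ i⟩) = p := by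
  refine Sigma.ext rfl (heq_of_eq ?_)
  apply Limits.Pi.hom_ext
  intro i
  simp [pack]

theorem cartesianClosedP_fam [HasLimits K] (h : CartesianMultiClosedOf K) :
    CartesianClosedP (FormalCoproduct.{v} K) := by
  have : HasFiniteLimits K := inferInstance
  apply cartesianClosedP_of_criterion
  intro A B
  choose T E0 ev0 P hP hu using h
  let S : A.I → Type v := fun i => Σ j : B.I, T (A.obj i) (B.obj j)
  let EE : ∀ i, S i → K := fun i s => E0 (A.obj i) (B.obj s.1) s.2
  let E : FormalCoproduct.{v} K := ⟨∀ i, S i, fun s => ∏ᶜ fun i => EE i (s i)⟩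
  let ev : famProd A E ⟶ B := ⟨fun p => (p.2 p.1).1, fun p =>
    prod.map (𝟙 _) (Pi.π (fun i => EE i (p.2 i)) p.1) ≫ ev0 _ _ (p.2 p.1).2⟩
  refine ⟨E, ev, ?_⟩
  intro X c
  let Q : (famProd A X ⟶ B) → ∀ x i, Σ s : S i, X.obj x ⟶ EE i s := fun c x i =>
    ⟨⟨c.f (i, x), (P _ _ _ (c.φ (i, x))).1⟩, (P _ _ _ (c.φ (i, x))).2⟩
  refine ⟨ofSg fun x => pack EE (Q c x), ?_, ?_⟩
  · apply sg_ext
    rintro ⟨i, x⟩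
    refine Sigma.ext rfl (heq_of_eq ?_)
    refine Eq.trans ?_ (hP _ _ _ (c.φ (i, x)))
    change prod.map (𝟙 _) (Pi.lift fun i => (Q c x i).2) ≫ prod.map (𝟙 _) (Pi.π _ i) ≫ ev0 _ _ _ = _
    rw [← Category.assoc, prod.map_map]
    simp [Q]
  · rintro g rfl
    apply sg_ext
    intro x
    rw [sg_ofSg]
    refine (pack_unpack EE (sg g x)).symm.trans (congrArg _ ?_)
    funext i
    have := hu (A.obj i) (B.obj (g.f x i).1) (X.obj x)
      ((famProdMap A g ≫ ev).φ (i, x)) ⟨(g.f x i).2, g.φ x ≫ Pi.π _ i⟩ (by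
        change _ = prod.map (𝟙 _) (g.φ x) ≫ prod.map (𝟙 _) (Pi.π _ i) ≫ ev0 _ _ _
        rw [← Category.assoc, prod.map_map]
        simp)
    exact congrArg (fun r : Σ t, X.obj x ⟶ E0 (A.obj i) (B.obj (g.f x i).1) t =>
      (⟨⟨(g.f x i).1, r.1⟩, r.2⟩ : Σ s : S i, X.obj x ⟶ EE i s)) this

theorem multiClosed_of_fam [HasFiniteLimits K] (h : CartesianClosedP (FormalCoproduct.{v} K)) :
    CartesianMultiClosedOf K := by
  obtain ⟨h1, ⟨h2⟩⟩ := h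
  intro A B
  let A' := (incl.{v} K).obj A
  let B' := (incl.{v} K).obj B
  let E : FormalCoproduct.{v} K := (ihom A').obj B'
  let j : ∀ X : K, (incl.{v} K).obj (A ⨯ X) ≅ famProd A' ((incl.{v} K).obj X) := fun X =>
    isoOfComponents ⟨fun _ => (⟨⟩, ⟨⟩), fun _ => ⟨⟩, fun _ => rfl, fun _ => rfl⟩
      (fun _ => Iso.refl _)
  let Θ : ∀ X : K, (A ⨯ X ⟶ B) ≃ (Σ i : E.I, X ⟶ E.obj i) := fun X =>
    (fullyFaithfulIncl.{v}.homEquiv (X := A ⨯ X) (Y := B)).trans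
      ((((j X ≪≫ famProdIso A' _).homFromEquiv (Z := B')).trans
        ((ihom.adjunction A').homEquiv _ _)).trans (inclHomEquiv X E))
  have hΘ : ∀ {X Y : K} (g : X ⟶ Y) (c : A ⨯ Y ⟶ B),
      Θ X (prod.map (𝟙 A) g ≫ c) = ⟨(Θ Y c).1, g ≫ (Θ Y c).2⟩ := by
    intro X Y g c
    have hj : (incl.{v} K).map (prod.map (𝟙 A) g) ≫ (j Y).hom =
        (j X).hom ≫ famProdMap A' ((incl.{v} K).map g) :=
      sg_ext fun _ => Sigma.ext rfl (heq_of_eq (by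
        change prod.map (𝟙 A) g ≫ 𝟙 _ = 𝟙 _ ≫ prod.map (𝟙 A) g
        simp))
    have hn := famProdIso_nat A' ((incl.{v} K).map g)
    have h3 : (j X ≪≫ famProdIso A' _).inv ≫ (incl.{v} K).map (prod.map (𝟙 A) g ≫ c) =
        A' ◁ (incl.{v} K).map g ≫ (j Y ≪≫ famProdIso A' _).inv ≫ (incl.{v} K).map c := by
      rw [Iso.inv_comp_eq, Functor.map_comp, ← Category.assoc, ← Category.assoc]
      congr 1
      rw [Iso.eq_comp_inv]
      simp only [Iso.trans_hom, Category.assoc]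
      rw [← hn, ← Category.assoc, hj, Category.assoc]
    have h4 : ((ihom.adjunction A').homEquiv _ _)
        ((j X ≪≫ famProdIso A' _).inv ≫ (incl.{v} K).map (prod.map (𝟙 A) g ≫ c)) =
        (incl.{v} K).map g ≫ ((ihom.adjunction A').homEquiv _ _)
          ((j Y ≪≫ famProdIso A' _).inv ≫ (incl.{v} K).map c) := by
      rw [h3]
      exact Adjunction.homEquiv_naturality_left _ _ _
    have h5 := congrArg (inclHomEquiv X E) h4
    exact h5
  clear_value Θ
  have hΘ' : ∀ (X : K) (q : Σ i : E.I, X ⟶ E.obj i),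
      Θ X (prod.map (𝟙 A) q.2 ≫ (Θ _).symm ⟨q.1, 𝟙 _⟩) = q := by
    intro X q
    rw [hΘ, Equiv.apply_symm_apply]
    exact Sigma.ext rfl (heq_of_eq (Category.comp_id _))
  refine ⟨E.I, E.obj, fun i => (Θ _).symm ⟨i, 𝟙 _⟩, fun X c => ⟨Θ X c, ?_, ?_⟩⟩
  · exact (Θ X).injective (hΘ' X _)
  · rintro q rfl
    exact (hΘ' X q).symm

/-! ### Subobject classifiers -/

theorem isPullback_mono_iff {C : Type u} [Category.{v} C] {T Ω U X : C} (hT : IsTerminal T)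
    (ε : T ⟶ Ω) (m : U ⟶ X) (hm : Mono m) (χ : X ⟶ Ω) :
    IsPullback (hT.from U) m ε χ ↔ (m ≫ χ = hT.from U ≫ ε ∧
      ∀ (Z : C) (z : Z ⟶ X), z ≫ χ = hT.from Z ≫ ε → ∃ l : Z ⟶ U, l ≫ m = z) := by
  constructor
  · intro h
    refine ⟨h.w.symm, fun Z z hz => ⟨h.lift (hT.from Z) z hz.symm, h.lift_snd _ _ _⟩⟩
  · rintro ⟨h1, h2⟩
    have hc : ∀ s : PullbackCone ε χ, s.snd ≫ χ = hT.from s.pt ≫ ε := fun s => by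
      rw [← s.condition]
      congr 1
      exact hT.hom_ext _ _
    refine ⟨⟨h1.symm⟩, ⟨PullbackCone.IsLimit.mk _
      (fun s => (h2 s.pt s.snd (hc s)).choose) ?_ ?_ ?_⟩⟩
    · intro s
      exact hT.hom_ext _ _
    · intro s
      exact (h2 s.pt s.snd (hc s)).choose_spec
    · intro s l _ hl
      rw [← cancel_mono m, hl]
      exact (h2 s.pt s.snd (hc s)).choose_spec.symm

/-- Element of a sigma type as a morphism from a singleton family. -/
def elt {X : FormalCoproduct.{v} K} {Z : K} (q : Σ x : X.I, Z ⟶ X.obj x) :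
    (incl.{v} K).obj Z ⟶ X := ofSg fun _ => q

theorem elt_comp {X Y : FormalCoproduct.{v} K} {Z : K} (q : Σ x : X.I, Z ⟶ X.obj x) (g : X ⟶ Y) :
    elt q ≫ g = elt (sgMap g q) := rfl

theorem elt_inj {X : FormalCoproduct.{v} K} {Z : K} {q q' : Σ x : X.I, Z ⟶ X.obj x}
    (h : elt q = elt q') : q = q' :=
  congrArg (fun f : (incl.{v} K).obj Z ⟶ X => sg f ⟨⟩) h

theorem elt_sg {X : FormalCoproduct.{v} K} {Z : K} (f : (incl.{v} K).obj Z ⟶ X) :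
    elt (sg f ⟨⟩) = f := rfl

theorem sgMap_inj {U X : FormalCoproduct.{v} K} (m : U ⟶ X) [Mono m] {Z : K}
    {q q' : Σ x : U.I, Z ⟶ U.obj x} (h : sgMap m q = sgMap m q') : q = q' := by
  apply elt_inj
  rw [← cancel_mono m, elt_comp, elt_comp, h]

theorem exists_common [HasPullbacks K] {X : FormalCoproduct.{v} K} {A B : K} {x x' : X.I}
    (e : x = x') (a : A ⟶ X.obj x) (b : B ⟶ X.obj x') :
    ∃ (P : K) (p : P ⟶ A) (q : P ⟶ B),
      (⟨x, p ≫ a⟩ : Σ x : X.I, P ⟶ X.obj x) = ⟨x', q ≫ b⟩ := by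
  subst e
  exact ⟨pullback a b, pullback.fst _ _, pullback.snd _ _, by rw [pullback.condition]⟩

theorem mono_f_inj [HasPullbacks K] {U X : FormalCoproduct.{v} K} (m : U ⟶ X) [Mono m] :
    Function.Injective m.f := by
  intro u u' h
  obtain ⟨P, p, q, hpq⟩ := exists_common h (m.φ u) (m.φ u')
  exact congrArg Sigma.fst (sgMap_inj m (q := ⟨u, p⟩) (q' := ⟨u', q⟩) hpq)

theorem sigma_snd_eq {ι : Type v} {β : ι → Type v} {i : ι} {a b : β i}
    (h : (⟨i, a⟩ : Sigma β) = ⟨i, b⟩) : a = b := eq_of_heq (Sigma.mk.inj h).2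

theorem mono_φ {U X : FormalCoproduct.{v} K} (m : U ⟶ X) [Mono m] (u : U.I) :
    Mono (m.φ u) := by
  constructor
  intro Z a b h
  have : (⟨u, a⟩ : Σ x : U.I, Z ⟶ U.obj x) = ⟨u, b⟩ := by
    apply sgMap_inj m
    exact Sigma.ext rfl (heq_of_eq h)
  exact sigma_snd_eq this

/-- Pullback criterion in families, in terms of singleton families. -/
theorem fam_isPullback_iff {T : K} (hT : IsTerminal T) {Ω U X : FormalCoproduct.{v} K}
    (ε : Σ w : Ω.I, T ⟶ Ω.obj w) (m : U ⟶ X) (hm : Mono m) (χ : X ⟶ Ω) :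
    IsPullback ((isTerminalIncl T hT).from U) m (elt ε) χ ↔
      ((∀ u, sgMap χ (sg m u) = ⟨ε.1, hT.from _ ≫ ε.2⟩) ∧
      ∀ (Z : K) (z : Σ x : X.I, Z ⟶ X.obj x), sgMap χ z = ⟨ε.1, hT.from _ ≫ ε.2⟩ →
        ∃ l : Σ u : U.I, Z ⟶ U.obj u, sgMap m l = z) := by
  have key : ∀ W : FormalCoproduct.{v} K,
      ∀ w, sg ((isTerminalIncl T hT).from W ≫ elt ε) w = ⟨ε.1, hT.from _ ≫ ε.2⟩ := by
    intro W w
    exact Sigma.ext rfl (heq_of_eq (congrArg (· ≫ ε.2) (hT.hom_ext _ _)))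
  rw [isPullback_mono_iff _ _ _ hm]
  constructor
  · rintro ⟨h1, h2⟩
    refine ⟨fun u => ?_, fun Z z hz => ?_⟩
    · rw [← sg_comp, h1, key]
    · obtain ⟨l, hl⟩ := h2 _ (elt z) (sg_ext fun w => by
        rw [key, sg_comp]; exact hz)
      refine ⟨sg l ⟨⟩, elt_inj ?_⟩
      exact hl
  · rintro ⟨h1, h2⟩
    refine ⟨sg_ext fun u => by rw [key, sg_comp, h1], fun Z z hz => ?_⟩
    have : ∀ w, ∃ l : Σ u : U.I, Z.obj w ⟶ U.obj u, sgMap m l = sg z w := fun w => by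
      apply h2
      rw [← sg_comp, hz, key]
    choose l hl using this
    exact ⟨ofSg l, sg_ext fun w => hl w⟩

theorem classifier_of_fam [HasTerminal K]
    (h : HasSubobjectClassifierP (FormalCoproduct.{v} K)) : HasSubobjectClassifierP K := by
  obtain ⟨c⟩ := h.toClassifier
  let hT : IsTerminal (⊤_ K) := terminalIsTerminal
  obtain ⟨Ω, ε', _, h⟩ := HasSubobjectClassifierP.ofClassifier c (isTerminalIncl _ hT)
  obtain ⟨⟨i, e⟩, rfl⟩ : ∃ q, elt q = ε' := ⟨_, elt_sg ε'⟩
  refine ⟨⊤_ K, Ω.obj i, hT, e, hT.mono_from _, fun U X m hm => ?_⟩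
  have hm' : Mono ((incl.{v} K).map m) := by
    constructor
    intro Z a b hab
    apply sg_ext
    intro z
    have h1 : sg (a ≫ (incl.{v} K).map m) z = sg (b ≫ (incl.{v} K).map m) z := by rw [hab]
    have h2 : a.φ z ≫ m = b.φ z ≫ m :=
      sigma_snd_eq (ι := PUnit) (β := fun _ => (Z.obj z ⟶ X)) (i := ⟨⟩) h1
    exact Sigma.ext rfl (heq_of_eq ((cancel_mono m).1 h2))
  have key : ∀ k : X ⟶ Ω.obj i, IsPullback (hT.from U) m e k ↔
      IsPullback ((isTerminalIncl _ hT).from _) ((incl.{v} K).map m) (elt ⟨i, e⟩)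
        (elt ⟨i, k⟩) := by
    intro k
    rw [fam_isPullback_iff hT _ _ hm', isPullback_mono_iff _ _ _ hm]
    refine and_congr ⟨fun h _ => Sigma.ext rfl (heq_of_eq h), fun h => sigma_snd_eq (h ⟨⟩)⟩ ?_
    refine ⟨fun h Z z hz => ?_, fun h Z z hz => ?_⟩
    · obtain ⟨l, hl⟩ := h Z z.2 (sigma_snd_eq hz)
      exact ⟨⟨⟨⟩, l⟩, Sigma.ext rfl (heq_of_eq hl)⟩
    · obtain ⟨l, hl⟩ := h Z ⟨⟨⟩, z⟩ (Sigma.ext rfl (heq_of_eq hz))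
      exact ⟨l.2, sigma_snd_eq (ι := PUnit) (β := fun _ => (Z ⟶ X)) (i := ⟨⟩) hl⟩
  obtain ⟨χ, hχ, hu⟩ := h _ hm'
  obtain ⟨⟨i', k⟩, rfl⟩ : ∃ q, elt q = χ := ⟨_, elt_sg χ⟩
  have hi : i' = i := congrArg Sigma.fst (((fam_isPullback_iff hT _ _ hm' _).1 hχ).1 ⟨⟩)
  subst hi
  refine ⟨k, (key k).2 hχ, fun k' hk' => ?_⟩
  exact sigma_snd_eq (elt_inj (hu _ ((key k').1 hk')))

theorem classifier_fam [HasPullbacks K]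
    (h : HasSubobjectClassifierP K) : HasSubobjectClassifierP (FormalCoproduct.{v} K) := by
  obtain ⟨T, Ω, hT, ε, _, h⟩ := h
  let Ω' : FormalCoproduct.{v} K := ⟨Option PUnit, fun o => o.elim T (fun _ => Ω)⟩
  let ε' : Σ w : Ω'.I, T ⟶ Ω'.obj w := ⟨some ⟨⟩, ε⟩
  refine ⟨_, Ω', isTerminalIncl T hT, elt ε', (isTerminalIncl T hT).mono_from _, ?_⟩
  intro U X m hm
  have hinj := mono_f_inj m
  have hφ := mono_φ m
  -- pullback squares in families restrict to pullback squares
  have restrict : ∀ (χ : X ⟶ Ω'),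
      IsPullback ((isTerminalIncl T hT).from U) m (elt ε') χ → ∀ u (k : X.obj (m.f u) ⟶ Ω),
        sg χ (m.f u) = ⟨some ⟨⟩, k⟩ → IsPullback (hT.from _) (m.φ u) ε k := by
    intro χ hχ u k hk
    have hc : ∀ {Z : K} (z : Z ⟶ X.obj (m.f u)), sgMap χ ⟨m.f u, z⟩ =
        (⟨some ⟨⟩, z ≫ k⟩ : Σ w : Ω'.I, Z ⟶ Ω'.obj w) := by
      intro Z z
      exact congrArg (fun r : Σ w : Ω'.I, X.obj (m.f u) ⟶ Ω'.obj w =>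
        (⟨r.1, z ≫ r.2⟩ : Σ w : Ω'.I, Z ⟶ Ω'.obj w)) hk
    rw [fam_isPullback_iff hT _ _ hm] at hχ
    rw [isPullback_mono_iff _ _ _ (hφ u)]
    refine ⟨?_, fun Z z hz => ?_⟩
    · exact sigma_snd_eq (β := fun w => U.obj u ⟶ Ω'.obj w) (i := some ⟨⟩)
        ((hc (m.φ u)).symm.trans (hχ.1 u))
    · obtain ⟨⟨u', l⟩, hl⟩ := hχ.2 Z ⟨m.f u, z⟩ ((hc z).trans (Sigma.ext rfl (heq_of_eq hz)))
      have hu : u' = u := hinj (congrArg Sigma.fst hl)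
      subst hu
      exact ⟨l, sigma_snd_eq hl⟩
  have outside : ∀ (χ : X ⟶ Ω'),
      IsPullback ((isTerminalIncl T hT).from U) m (elt ε') χ → ∀ x, (¬ ∃ u, m.f u = x) →
        sg χ x = ⟨none, hT.from _⟩ := by
    intro χ hχ x hx
    rw [fam_isPullback_iff hT _ _ hm] at hχ
    rcases hk : sg χ x with ⟨_ | _, k⟩
    · exact Sigma.ext rfl (heq_of_eq (hT.hom_ext _ _))
    · exfalso
      let k' : X.obj x ⟶ Ω := k
      obtain ⟨l, hl⟩ := hχ.2 (pullback k' ε) ⟨x, pullback.fst k' ε⟩ (by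
        have : sgMap χ ⟨x, pullback.fst k' ε⟩ =
            (⟨some ⟨⟩, pullback.fst k' ε ≫ k'⟩ : Σ w : Ω'.I, pullback k' ε ⟶ Ω'.obj w) :=
          congrArg (fun r : Σ w : Ω'.I, X.obj x ⟶ Ω'.obj w =>
            (⟨r.1, pullback.fst k' ε ≫ r.2⟩ : Σ w : Ω'.I, pullback k' ε ⟶ Ω'.obj w)) hk
        have h0 : pullback.fst k' ε ≫ k' = hT.from _ ≫ ε := by
          rw [pullback.condition, hT.hom_ext (pullback.snd k' ε) (hT.from _)]
        exact this.trans (Sigma.ext rfl (heq_of_eq h0)))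
      exact hx ⟨l.1, congrArg Sigma.fst hl⟩
  choose χ0 hχ0 hu0 using fun u => h (m.φ u) (hφ u)
  have ex : ∀ x, ∃ q : Σ w : Ω'.I, X.obj x ⟶ Ω'.obj w,
      (∃ u, (⟨x, q⟩ : Σ x : X.I, Σ w : Ω'.I, X.obj x ⟶ Ω'.obj w) =
        ⟨m.f u, ⟨some ⟨⟩, χ0 u⟩⟩) ∨ ((¬ ∃ u, m.f u = x) ∧ q = ⟨none, hT.from _⟩) := by
    intro x
    by_cases hx : ∃ u, m.f u = x
    · obtain ⟨u, rfl⟩ := hx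
      exact ⟨⟨some ⟨⟩, χ0 u⟩, Or.inl ⟨u, rfl⟩⟩
    · exact ⟨⟨none, hT.from _⟩, Or.inr ⟨hx, rfl⟩⟩
  choose q hq using ex
  have hq1 : ∀ u, q (m.f u) = ⟨some ⟨⟩, χ0 u⟩ := by
    intro u
    rcases hq (m.f u) with ⟨u', hu'⟩ | ⟨h1, _⟩
    · have : u = u' := hinj (congrArg Sigma.fst hu')
      subst this
      exact eq_of_heq (Sigma.mk.inj hu').2
    · exact absurd ⟨u, rfl⟩ h1
  have hq2 : ∀ x, (¬ ∃ u, m.f u = x) → q x = ⟨none, hT.from _⟩ := by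
    intro x hx
    rcases hq x with ⟨u', hu'⟩ | ⟨_, h2⟩
    · exact absurd ⟨u', (congrArg Sigma.fst hu').symm⟩ hx
    · exact h2
  refine ⟨ofSg q, ?_, ?_⟩
  · change IsPullback _ _ _ _
    rw [fam_isPullback_iff hT _ _ hm]
    have hc : ∀ u {Z : K} (z : Z ⟶ X.obj (m.f u)), sgMap (ofSg q) ⟨m.f u, z⟩ =
        (⟨some ⟨⟩, z ≫ χ0 u⟩ : Σ w : Ω'.I, Z ⟶ Ω'.obj w) := by
      intro u Z z
      exact congrArg (fun r : Σ w : Ω'.I, X.obj (m.f u) ⟶ Ω'.obj w =>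
        (⟨r.1, z ≫ r.2⟩ : Σ w : Ω'.I, Z ⟶ Ω'.obj w)) (hq1 u)
    refine ⟨fun u => ?_, ?_⟩
    · refine (hc u (m.φ u)).trans ?_
      exact Sigma.ext rfl (heq_of_eq (hχ0 u).w.symm)
    · rintro Z ⟨x, z⟩ hz
      by_cases hx : ∃ u, m.f u = x
      · obtain ⟨u, rfl⟩ := hx
        have hz' : z ≫ χ0 u = hT.from Z ≫ ε :=
          sigma_snd_eq (β := fun w => Z ⟶ Ω'.obj w) (i := some ⟨⟩) ((hc u z).symm.trans hz)
        obtain ⟨l, hl⟩ := ((isPullback_mono_iff hT ε _ (hφ u) _).1 (hχ0 u)).2 Z z hz'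
        exact ⟨⟨u, l⟩, Sigma.ext rfl (heq_of_eq hl)⟩
      · have h1 : (q x).1 = some ⟨⟩ := congrArg Sigma.fst hz
        rw [hq2 x hx] at h1
        cases h1
  · intro χ hχ
    apply sg_ext
    intro x
    rw [sg_ofSg]
    by_cases hx : ∃ u, m.f u = x
    · obtain ⟨u, rfl⟩ := hx
      rw [hq1]
      have h1 : (sg χ (m.f u)).1 = some ⟨⟩ :=
        congrArg Sigma.fst (((fam_isPullback_iff hT _ _ hm _).1 hχ).1 u)
      rcases hk : sg χ (m.f u) with ⟨_ | _, k⟩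
      · rw [hk] at h1; cases h1
      · exact Sigma.ext rfl (heq_of_eq (hu0 u k (restrict χ hχ u k hk)))
    · rw [hq2 x hx]
      exact outside χ hχ x hx

theorem topos_fam_iff [HasLimits K] :
    IsElementaryTopos (FormalCoproduct.{v} K) ↔ IsMultiTopos K := by
  have hK : HasFiniteLimits K := inferInstance
  constructor
  · rintro ⟨_, h2, h3⟩
    exact ⟨hK, ⟨inferInstance, multiClosed_of_fam h2⟩, classifier_of_fam h3⟩
  · rintro ⟨_, ⟨_, h2⟩, h3⟩
    exact ⟨hasFiniteLimits_of_hasTerminal_and_pullbacks, cartesianClosedP_fam h2,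
      classifier_fam h3⟩

end Helpers

universe v u

/-- Theorem 2.16: for a complete category `𝒦`, the completion `Σ𝒦` is an
elementary topos iff `𝒦` is a multi-topos. -/
theorem sigmaCompletion_topos_iff_multiTopos (K : Type u) [Category.{v} K] [HasLimits K] :
    IsElementaryTopos (SigmaCompletion K) ↔ IsMultiTopos K := by
  exact topos_sigma_iff.trans topos_fam_iff

end FreeCompletions
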